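/- In the ring of formal power series ℤ[[X]], the infinite product ∏_{n=1}^∞ (1 - X^n) equals the series 1 + ∑_{n=1}^∞ (-1)^n (X^{n(3n-1)/2} + X^{n(3n+1)/2}); equivalently, ∏_{n=1}^∞ (1 - X^n) = ∑_{n∈ℤ} (-1)^n X^{n(3n+1)/2} (Euler's pentagonal number theorem). -/

import Mathlib

open PowerSeries

/-- The `X`-adic topology on `ℤ⟦X⟧`: since `ℤ` is discrete, it coincides with the
product topology on coefficients. -/
noncomputable instance : TopologicalSpace ℤ⟦X⟧ :=
  inferInstanceAs (TopologicalSpace ((Unit →₀ ℕ) → ℤ))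

theorem pent_topology_eq :
    (inferInstance : TopologicalSpace ℤ⟦X⟧) = PowerSeries.WithPiTopology.instTopologicalSpace ℤ := rfl

theorem pent_t2 : T2Space ℤ⟦X⟧ := PowerSeries.WithPiTopology.instT2Space ℤ

theorem pent_topring : IsTopologicalRing ℤ⟦X⟧ :=
  PowerSeries.WithPiTopology.instIsTopologicalRing ℤ

theorem pent_hasProd :
    HasProd (fun n : ℕ ↦ (1 - X ^ (n + 1) : ℤ⟦X⟧)) (pentagonalSeries ℤ) :=
  PowerSeries.WithPiTopology.hasProd_one_sub_X_pow ℤ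

theorem pent_hasSum :
    HasSum (fun k : ℤ ↦ ((k.negOnePow : ℤ) : ℤ⟦X⟧) * X ^ pentagonal k) (pentagonalSeries ℤ) :=
  PowerSeries.WithPiTopology.hasSum_pentagonalSeries ℤ

theorem pent_hasSum_neg :
    HasSum (fun n : ℤ ↦ ((n.negOnePow : ℤ) : ℤ⟦X⟧) * X ^ (n * (3 * n + 1) / 2).toNat)
      (pentagonalSeries ℤ) := by
  have h := (Equiv.neg ℤ).hasSum_iff.mpr pent_hasSum
  convert h using 2 with n
  simp [pentagonal_neg]

theorem pent_hasSum_nat :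
    HasSum (fun n : ℕ ↦ (-1 : ℤ⟦X⟧) ^ (n + 1) *
        (X ^ ((n + 1) * (3 * (n + 1) - 1) / 2) + X ^ ((n + 1) * (3 * (n + 1) + 1) / 2)))
      (pentagonalSeries ℤ - 1) := by
  have := pent_topring
  have h := (hasSum_nat_add_iff' 1).mpr pent_hasSum.nat_add_neg
  convert h using 1
  · rfl
  · funext n
    have e1 : pentagonal ((n + 1 : ℕ) : ℤ) = (n + 1) * (3 * (n + 1) - 1) / 2 := by
      have := two_mul_natCast_pentagonal ((n + 1 : ℕ) : ℤ)
      have h2 : 2 * pentagonal ((n + 1 : ℕ) : ℤ) = (n + 1) * (3 * (n + 1) - 1) := by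
        rw [show 3 * (n + 1) - 1 = 3 * n + 2 by omega]
        zify
        push_cast at this; rw [this]; try ring
      omega
    have e2 : pentagonal (-((n + 1 : ℕ) : ℤ)) = (n + 1) * (3 * (n + 1) + 1) / 2 := by
      have := two_mul_natCast_pentagonal_neg ((n + 1 : ℕ) : ℤ)
      have h2 : 2 * pentagonal (-((n + 1 : ℕ) : ℤ)) = (n + 1) * (3 * (n + 1) + 1) := by
        zify
        push_cast at this; rw [this]; try ring
      omega
    rw [e1, e2, Int.negOnePow_neg, mul_add]
    simp [Int.coe_negOnePow_natCast, Int.negOnePow_succ, pow_succ]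
    try ring
  · simp [pentagonal_def]
    try ring

/-- Euler's pentagonal number theorem in `ℤ⟦X⟧`:
`∏_{n=1}^∞ (1 - X^n) = 1 + ∑_{n=1}^∞ (-1)^n (X^{n(3n-1)/2} + X^{n(3n+1)/2})`,
equivalently `∏_{n=1}^∞ (1 - X^n) = ∑_{n ∈ ℤ} (-1)^n X^{n(3n+1)/2}`. -/
theorem euler_pentagonal_number_theorem :
    ((∏' n : ℕ, (1 - (X : ℤ⟦X⟧) ^ (n + 1))) =
      1 + ∑' n : ℕ, (-1 : ℤ⟦X⟧) ^ (n + 1) *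
        (X ^ ((n + 1) * (3 * (n + 1) - 1) / 2) + X ^ ((n + 1) * (3 * (n + 1) + 1) / 2))) ∧
    ((∏' n : ℕ, (1 - (X : ℤ⟦X⟧) ^ (n + 1))) =
      ∑' n : ℤ, ((n.negOnePow : ℤ) : ℤ⟦X⟧) * X ^ (n * (3 * n + 1) / 2).toNat) := by
  have := pent_t2
  rw [pent_hasProd.tprod_eq, pent_hasSum_nat.tsum_eq, pent_hasSum_neg.tsum_eq]
  exact ⟨by ring, rfl⟩
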